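/- arXiv:math/9804023 — 2 statements merged into one kernel-verified Lean document; each statement's English description precedes it below -/
import Mathlib

section
/- Let K be a symmetric convex body in ℝ^(2n) that is r-semiround with respect to the Euclidean unit ball E (i.e., Vol(K)/Vol(E) ≤ r^(2n)) and contains E. Then there exists an n-dimensional linear subspace V'' and a point direction such that the slice K'' = K ∩ V'' and the Euclidean unit ball E'' = E ∩ V'' satisfy Vol(K'')/Vol(E'') ≤ (2r)^(2n)·s^(-n), where s is the maximal Euclidean norm of a point in an intermediate (n+1)-dimensional slice K' containing K''. -/
open MeasureTheory

theorem lintegral_fun_norm_addHaar {E : Type*} [NormedAddCommGroup E] [NormedSpace ℝ E]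
    [MeasurableSpace E] [BorelSpace E] [FiniteDimensional ℝ E] [Nontrivial E]
    (μ : Measure E) [μ.IsAddHaarMeasure] {f : ℝ → ENNReal} (hf : Measurable f) :
    ∫⁻ x, f ‖x‖ ∂μ = Module.finrank ℝ E * μ (Metric.ball 0 1) *
      ∫⁻ y in Set.Ioi (0 : ℝ), ENNReal.ofReal (y ^ (Module.finrank ℝ E - 1)) * f y := by
  calc
    ∫⁻ x, f ‖x‖ ∂μ = ∫⁻ x : ({(0)}ᶜ : Set E), f (‖x.1‖) ∂(μ.comap (↑)) := by
      rw [lintegral_subtype_comap (measurableSet_singleton _).compl fun x ↦ f (‖x‖),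
        restrict_compl_singleton]
    _ = ∫⁻ x, f x.2 ∂μ.toSphere.prod (.volumeIoiPow (Module.finrank ℝ E - 1)) := by
      simpa using μ.measurePreserving_homeomorphUnitSphereProd.lintegral_comp_emb
        (Homeomorph.measurableEmbedding _) (f ∘ Subtype.val ∘ Prod.snd)
    _ = μ.toSphere Set.univ *
        ∫⁻ x : Set.Ioi (0 : ℝ), f x ∂.volumeIoiPow (Module.finrank ℝ E - 1) := by
      rw [lintegral_prod _ (by fun_prop)]
      simp [mul_comm]
    _ = _ := by
      rw [μ.toSphere_apply_univ, Measure.volumeIoiPow,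
        lintegral_withDensity_eq_lintegral_mul _ (by fun_prop) (by fun_prop),
        ← lintegral_subtype_comap measurableSet_Ioi]
      rfl

theorem lintegral_eq_lintegral_span_orthogonal {V : Type*} [NormedAddCommGroup V]
    [InnerProductSpace ℝ V] [FiniteDimensional ℝ V] [MeasurableSpace V] [BorelSpace V]
    {p : V} (hp : p ≠ 0) {f : V → ENNReal} (hf : Measurable f) :
    ∫⁻ x, f x = ‖p‖ₑ * ∫⁻ t : ℝ, ∫⁻ w : (ℝ ∙ p)ᗮ, f (t • p + w) := by
  have hmp := (ℝ ∙ p).orthogonalDecomposition.symm.measurePreserving.comp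
    (WithLp.volume_preserving_toLp (ℝ ∙ p) (ℝ ∙ p)ᗮ)
  have hp' : (⟨p, Submodule.mem_span_singleton_self p⟩ : ℝ ∙ p) ≠ 0 := by
    simpa [Subtype.ext_iff] using hp
  rw [← hmp.lintegral_comp hf, Measure.volume_eq_prod, lintegral_prod _ (by fun_prop),
    volume_eq_of_finrank_eq_one (finrank_span_singleton hp) hp', lintegral_smul_measure,
    lintegral_map _ (by fun_prop)]
  · simp [Submodule.orthogonalDecomposition_symm_apply]
    rfl
  · apply Measurable.lintegral_prod_right
    fun_prop

theorem lintegral_pow_mul_one_sub_pow (a b : ℕ) :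
    ∫⁻ t in Set.Ioo (0 : ℝ) 1, ENNReal.ofReal (t ^ a * (1 - t) ^ b) =
      ENNReal.ofReal (a.factorial * b.factorial / (a + b + 1).factorial) := by
  have ha : (0 : ℝ) < a + 1 := by positivity
  have hb : (0 : ℝ) < b + 1 := by positivity
  have hB := ProbabilityTheory.beta_pos ha hb
  have h := ProbabilityTheory.lintegral_betaPDF_eq_one ha hb
  rw [ProbabilityTheory.lintegral_betaPDF] at h
  simp only [add_sub_cancel_right, Real.rpow_natCast, mul_assoc] at h
  simp_rw [ENNReal.ofReal_mul (one_div_pos.2 hB).le] at h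
  rw [lintegral_const_mul _ (by fun_prop)] at h
  have h2 : ProbabilityTheory.beta (a + 1) (b + 1) =
      a.factorial * b.factorial / (a + b + 1).factorial := by
    rw [ProbabilityTheory.beta, Real.Gamma_nat_eq_factorial, Real.Gamma_nat_eq_factorial,
      show (a + 1 + (b + 1) : ℝ) = ((a + b + 1 : ℕ) : ℝ) + 1 by push_cast; ring,
      Real.Gamma_nat_eq_factorial]
  rw [← h2]
  calc _ = ENNReal.ofReal (ProbabilityTheory.beta (a + 1) (b + 1)) *
        (ENNReal.ofReal (1 / ProbabilityTheory.beta (a + 1) (b + 1)) *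
        ∫⁻ t in Set.Ioo (0 : ℝ) 1, ENNReal.ofReal (t ^ a * (1 - t) ^ b)) := by
        rw [← mul_assoc, ← ENNReal.ofReal_mul hB.le, mul_one_div_cancel hB.ne']
        simp
    _ = _ := by rw [h, mul_one]

open scoped Pointwise in
theorem cone_le_setLIntegral_norm_pow {V : Type*} [NormedAddCommGroup V]
    [InnerProductSpace ℝ V] [FiniteDimensional ℝ V] [MeasurableSpace V] [BorelSpace V]
    {A : Set V} (hA : Convex ℝ A) (hAm : MeasurableSet A) {p : V} (hpA : p ∈ A) (hp : p ≠ 0)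
    (k m : ℕ) (hm : Module.finrank ℝ (ℝ ∙ p)ᗮ = m) :
    ENNReal.ofReal (‖p‖ ^ (k + 1) * (k.factorial * m.factorial / (k + m + 1).factorial)) *
      volume ((↑) ⁻¹' A : Set (ℝ ∙ p)ᗮ) ≤ ∫⁻ x in A, ENNReal.ofReal (‖x‖ ^ k) := by
  rw [← lintegral_indicator hAm, lintegral_eq_lintegral_span_orthogonal hp
    (Measurable.indicator (by fun_prop) hAm), pow_succ', mul_assoc,
    ENNReal.ofReal_mul (norm_nonneg p), ofReal_norm, mul_assoc]
  gcongr
  rw [ENNReal.ofReal_mul (by positivity), ← lintegral_pow_mul_one_sub_pow,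
    ← lintegral_const_mul _ (by fun_prop), ← lintegral_mul_const _ (by fun_prop)]
  refine le_trans (setLIntegral_mono' measurableSet_Ioo fun t ht => ?_)
    (setLIntegral_le_lintegral (Set.Ioo 0 1) _)
  have h1 : 0 < 1 - t := sub_pos.2 ht.2
  have hvol : volume ((1 - t) • ((↑) ⁻¹' A : Set (ℝ ∙ p)ᗮ)) =
      ENNReal.ofReal ((1 - t) ^ m) * volume ((↑) ⁻¹' A : Set (ℝ ∙ p)ᗮ) := by
    rw [Measure.addHaar_smul, hm, abs_of_nonneg (by positivity)]
  calc _ = ENNReal.ofReal ((t * ‖p‖) ^ k) * volume ((1 - t) • ((↑) ⁻¹' A : Set (ℝ ∙ p)ᗮ)) := by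
        rw [hvol, ← mul_assoc, ← ENNReal.ofReal_mul (by positivity),
          ← ENNReal.ofReal_mul (by have := ht.1; positivity)]
        congr 2; ring
    _ = ∫⁻ w in (1 - t) • ((↑) ⁻¹' A : Set (ℝ ∙ p)ᗮ), ENNReal.ofReal ((t * ‖p‖) ^ k) := by
        rw [setLIntegral_const]
    _ ≤ ∫⁻ w in (1 - t) • ((↑) ⁻¹' A : Set (ℝ ∙ p)ᗮ),
        A.indicator (fun x => ENNReal.ofReal (‖x‖ ^ k)) (t • p + w) := by
        refine setLIntegral_mono' ((measurable_subtype_coe hAm).const_smul₀ _) fun w hw => ?_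
        have hwA : t • p + (w : V) ∈ A := by
          obtain ⟨v, hv, rfl⟩ := hw
          exact hA hpA hv ht.1.le h1.le (by ring)
        rw [Set.indicator_of_mem hwA]
        have ht0 := ht.1
        gcongr
        have horth : inner ℝ (t • p) (w : V) = 0 := by
          rw [inner_smul_left, Submodule.mem_orthogonal_singleton_iff_inner_right.1 w.2, mul_zero]
        have hn := norm_add_sq_eq_norm_sq_add_norm_sq_of_inner_eq_zero _ _ horth
        rw [norm_smul, Real.norm_of_nonneg ht.1.le] at hn
        exact le_of_abs_le (abs_le_of_sq_le_sq (by nlinarith [norm_nonneg (w : V)]) (norm_nonneg _))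
    _ ≤ _ := setLIntegral_le_lintegral _ _

theorem exists_linearIsometry_setLIntegral_le {E F : Type*}
    [NormedAddCommGroup E] [InnerProductSpace ℝ E] [FiniteDimensional ℝ E]
    [MeasurableSpace E] [BorelSpace E]
    [NormedAddCommGroup F] [InnerProductSpace ℝ F] [FiniteDimensional ℝ F]
    [MeasurableSpace F] [BorelSpace F] [Nontrivial F]
    (hFE : Module.finrank ℝ F ≤ Module.finrank ℝ E) {K : Set E} (hK : MeasurableSet K) :
    ∃ L : F →ₗᵢ[ℝ] E,
      Module.finrank ℝ E * volume (Metric.ball (0 : E) 1) *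
        ∫⁻ x in L ⁻¹' K, ENNReal.ofReal (‖x‖ ^ (Module.finrank ℝ E - Module.finrank ℝ F)) ≤
      Module.finrank ℝ F * volume (Metric.ball (0 : F) 1) * volume K := by
  have hFpos : 0 < Module.finrank ℝ F := Module.finrank_pos
  have : Nontrivial E := Module.finrank_pos_iff.1 (hFpos.trans_le hFE)
  obtain ⟨e, he⟩ := exists_norm_eq E zero_le_one
  let G := unitary (E →L[ℝ] E)
  have : CompactSpace G := by
    refine isCompact_iff_compactSpace.1 (?_ : IsCompact (unitary (E →L[ℝ] E) : Set (E →L[ℝ] E)))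
    refine Metric.isCompact_of_isClosed_isBounded isClosed_unitary ?_
    refine (Metric.isBounded_closedBall (x := (0 : E →L[ℝ] E)) (r := 1)).subset fun u hu => ?_
    rw [mem_closedBall_zero_iff]
    refine ContinuousLinearMap.opNorm_le_bound _ zero_le_one fun x => ?_
    rw [Unitary.norm_map ⟨u, hu⟩, one_mul]
  let : MeasurableSpace G := borel G
  have : BorelSpace G := ⟨rfl⟩
  let μ : Measure G := Measure.haarMeasure ⊤
  have : IsProbabilityMeasure μ := ⟨Measure.haarMeasure_self⟩
  have hact : Continuous fun q : G × E => ((q.1⁻¹ : G) : E →L[ℝ] E) q.2 := by fun_prop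
  have hactinv (g : G) (x : E) : ((g⁻¹ : G) : E →L[ℝ] E) x =
    (Unitary.linearIsometryEquiv g).symm x := rfl
  let S : Set (G × E) := {q | ((q.1⁻¹ : G) : E →L[ℝ] E) q.2 ∈ K}
  have hS : MeasurableSet S := hact.measurable hK
  let φ : ℝ → ENNReal := fun t => μ ((fun g => (g, t • e)) ⁻¹' S)
  have hφm : Measurable φ :=
    (measurable_measure_prodMk_right hS).comp (measurable_id.smul_const e)
  have hφ (x : E) : μ ((fun g => (g, x)) ⁻¹' S) = φ ‖x‖ := by
    have hn : ‖‖x‖ • e‖ = ‖x‖ := by rw [norm_smul, he, mul_one, norm_norm]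
    let h : G := Unitary.linearIsometryEquiv.symm (ℝ ∙ (‖x‖ • e - x))ᗮ.reflection
    have hh : (h : E →L[ℝ] E) (‖x‖ • e) = x := Submodule.reflection_sub hn
    rw [← measure_preimage_mul μ h]
    congr 1
    ext g
    have : (((h * g)⁻¹ : G) : E →L[ℝ] E) x = ((g⁻¹ : G) : E →L[ℝ] E) (‖x‖ • e) := by
      conv_lhs => rw [← hh]
      rw [hactinv, hactinv, LinearIsometryEquiv.symm_apply_eq, map_mul,
        LinearIsometryEquiv.coe_mul, Function.comp_apply,
        LinearIsometryEquiv.apply_symm_apply]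
      rfl
    simp only [Set.mem_preimage, S, Set.mem_ofPred_eq, this]
  have hvol : volume K = Module.finrank ℝ E * volume (Metric.ball (0 : E) 1) *
      ∫⁻ y in Set.Ioi (0 : ℝ), ENNReal.ofReal (y ^ (Module.finrank ℝ E - 1)) * φ y := by
    rw [← lintegral_fun_norm_addHaar volume hφm]
    simp_rw [← hφ]
    rw [← Measure.prod_apply_symm hS, Measure.prod_apply hS]
    have (g : G) : volume (Prod.mk g ⁻¹' S) = volume K :=
      (Unitary.linearIsometryEquiv g).symm.measurePreserving.measure_preimage hK.nullMeasurableSet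
    simp [this]
  obtain ⟨L₀⟩ : Nonempty (F →ₗᵢ[ℝ] E) := by
    let v := stdOrthonormalBasis ℝ F
    let b := stdOrthonormalBasis ℝ E
    refine ⟨(v.toBasis.constr ℝ (b ∘ Fin.castLE hFE)).isometryOfOrthonormal (v := v.toBasis)
      (by simp) ?_⟩
    convert b.orthonormal.comp _ (Fin.castLE_injective hFE)
    ext i
    simp
  set k := Module.finrank ℝ E - Module.finrank ℝ F
  have hmeas : Measurable fun q : G × F =>
      S.indicator (fun _ => ENNReal.ofReal (‖q.2‖ ^ k)) (q.1, L₀ q.2) :=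
    Measurable.indicator (s := (fun q : G × F => (q.1, L₀ q.2)) ⁻¹' S) (by fun_prop)
      (hS.preimage (measurable_fst.prodMk (L₀.continuous.measurable.comp measurable_snd)))
  have havg : ∫⁻ g, (∫⁻ x : F, S.indicator (fun _ => ENNReal.ofReal (‖x‖ ^ k)) (g, L₀ x)) ∂μ =
      Module.finrank ℝ F * volume (Metric.ball (0 : F) 1) *
      ∫⁻ y in Set.Ioi (0 : ℝ), ENNReal.ofReal (y ^ (Module.finrank ℝ E - 1)) * φ y := by
    rw [lintegral_lintegral_swap hmeas.aemeasurable]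
    have (x : F) : ∫⁻ g, S.indicator (fun _ => ENNReal.ofReal (‖x‖ ^ k)) (g, L₀ x) ∂μ =
        ENNReal.ofReal (‖x‖ ^ k) * φ ‖x‖ := by
      rw [← L₀.norm_map x, ← hφ, L₀.norm_map, ← lintegral_indicator_const
        (measurable_prodMk_right hS)]
      rfl
    simp_rw [this]
    rw [lintegral_fun_norm_addHaar volume (f := fun t => ENNReal.ofReal (t ^ k) * φ t)
      (by fun_prop)]
    congr 1
    refine setLIntegral_congr_fun measurableSet_Ioi fun y hy => ?_
    have hy' : (0 : ℝ) < y := hy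
    rw [← mul_assoc, ← ENNReal.ofReal_mul (by positivity), ← pow_add]
    congr 4
    lia
  obtain ⟨g, hg⟩ := exists_le_lintegral (μ := μ)
    (f := fun g => ∫⁻ x : F, S.indicator (fun _ => ENNReal.ofReal (‖x‖ ^ k)) (g, L₀ x))
    (Measurable.lintegral_prod_right hmeas).aemeasurable
  rw [havg] at hg
  refine ⟨(Unitary.linearIsometryEquiv g).symm.toLinearIsometry.comp L₀, ?_⟩
  rw [← lintegral_indicator (LinearIsometry.continuous _ |>.measurable hK), hvol]
  refine (mul_le_mul' le_rfl hg).trans_eq ?_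
  ring

theorem Nat.centralBinom_sq_mul_le (n : ℕ) : n.centralBinom ^ 2 * (2 * n + 1) ≤ 16 ^ n := by
  induction n with
  | zero => simp
  | succ n ih =>
    have h := n.succ_mul_centralBinom_succ
    refine Nat.le_of_mul_le_mul_left (c := (n + 1) ^ 2) ?_ (by positivity)
    calc (n + 1) ^ 2 * ((n + 1).centralBinom ^ 2 * (2 * (n + 1) + 1))
        = ((n + 1) * (n + 1).centralBinom) ^ 2 * (2 * n + 3) := by ring
      _ = (n.centralBinom ^ 2 * (2 * n + 1)) * (4 * ((2 * n + 1) * (2 * n + 3))) := by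
        rw [h]; ring
      _ ≤ 16 ^ n * (4 * (4 * (n + 1) ^ 2)) :=
        Nat.mul_le_mul ih (Nat.mul_le_mul_left 4 (by nlinarith))
      _ = _ := by ring

theorem Real.Gamma_add_half_sq_le {x : ℝ} (hx : 0 < x) :
    Real.Gamma (x + 1 / 2) ^ 2 ≤ x * Real.Gamma x ^ 2 := by
  have h := Real.Gamma_mul_add_mul_le_rpow_Gamma_mul_rpow_Gamma hx (by linarith : 0 < x + 1)
    (by norm_num : (0 : ℝ) < 1 / 2) (by norm_num : (0 : ℝ) < 1 / 2) (by norm_num)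
  rw [show 1 / 2 * x + 1 / 2 * (x + 1) = x + 1 / 2 by ring, ← Real.sqrt_eq_rpow,
    ← Real.sqrt_eq_rpow, Real.Gamma_add_one hx.ne'] at h
  have hG := Real.Gamma_pos_of_pos hx
  calc _ ≤ (√(Real.Gamma x) * √(x * Real.Gamma x)) ^ 2 :=
        pow_le_pow_left₀ (Real.Gamma_pos_of_pos (by linarith)).le h 2
    _ = _ := by
      rw [mul_pow, Real.sq_sqrt hG.le, Real.sq_sqrt (by positivity)]; ring

theorem unitBall_volume_ratio_le {n : ℕ} (hn : 2 ≤ n) :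
    (n + 1) * (√Real.pi ^ (n + 1) / Real.Gamma (((n + 1 : ℕ) : ℝ) / 2 + 1)) ≤
      2 * n * ((n - 1).factorial * n.factorial / (2 * n).factorial) * 4 ^ n *
        (√Real.pi ^ n / Real.Gamma ((n : ℝ) / 2 + 1)) := by
  obtain ⟨k, rfl⟩ : ∃ k, n = k + 1 := ⟨n - 1, by omega⟩
  set n := k + 1
  have hn' : (2 : ℝ) ≤ n := by exact_mod_cast hn
  set x : ℝ := ((n : ℝ) + 1) / 2 with hx
  have hx0 : 0 < x := by positivity
  have hG := Real.Gamma_pos_of_pos hx0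
  have hG2 : 0 < Real.Gamma (x + 1 / 2) := Real.Gamma_pos_of_pos (by linarith)
  have hgam := Real.Gamma_add_half_sq_le hx0
  rw [show ((n + 1 : ℕ) : ℝ) / 2 + 1 = x + 1 by push_cast; ring, Real.Gamma_add_one hx0.ne',
    show (n : ℝ) / 2 + 1 = x + 1 / 2 by rw [hx]; ring]
  have hC : (0 : ℝ) < n.centralBinom := by exact_mod_cast n.centralBinom_pos
  have hfac : 2 * n * (((n - 1).factorial * n.factorial : ℝ) / (2 * n).factorial) =
      2 / n.centralBinom := by
    have h1 : ((2 * n).factorial : ℝ) = n.centralBinom * n.factorial * n.factorial := by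
      have := Nat.choose_mul_factorial_mul_factorial (show n ≤ 2 * n by omega)
      rw [show 2 * n - n = n by omega] at this
      rw [Nat.centralBinom_eq_two_mul_choose]
      exact_mod_cast this.symm
    have h2 : (n.factorial : ℝ) = n * (n - 1).factorial := by
      simp [n, Nat.factorial_succ]
    have h3 : (0 : ℝ) < n.factorial := by positivity
    rw [h1]
    field_simp
    rw [h2]
  rw [hfac]
  have hbin : (n.centralBinom : ℝ) ^ 2 * (2 * n + 1) ≤ 16 ^ n := by
    exact_mod_cast n.centralBinom_sq_mul_le
  have key : n.centralBinom * √Real.pi * Real.Gamma (x + 1 / 2) ≤ 4 ^ n * Real.Gamma x := by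
    refine le_of_abs_le (abs_le_of_sq_le_sq ?_ (by positivity))
    rw [mul_pow, mul_pow, mul_pow, Real.sq_sqrt Real.pi_pos.le, ← pow_mul, mul_comm n 2, pow_mul]
    norm_num
    calc _ ≤ (n.centralBinom : ℝ) ^ 2 * Real.pi * (x * Real.Gamma x ^ 2) := by gcongr
      _ ≤ (n.centralBinom : ℝ) ^ 2 * (2 * n + 1) * Real.Gamma x ^ 2 := by
        rw [mul_assoc, mul_assoc, ← mul_assoc Real.pi]
        gcongr
        nlinarith [Real.pi_lt_d2, Real.pi_pos]
      _ ≤ _ := by gcongr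
  have hxn : (n + 1 : ℝ) = 2 * x := by rw [hx]; ring
  rw [hxn, pow_succ]
  calc _ = 2 * √Real.pi ^ n / (n.centralBinom * Real.Gamma x * Real.Gamma (x + 1 / 2)) *
        (n.centralBinom * √Real.pi * Real.Gamma (x + 1 / 2)) := by field_simp
    _ ≤ 2 * √Real.pi ^ n / (n.centralBinom * Real.Gamma x * Real.Gamma (x + 1 / 2)) *
        (4 ^ n * Real.Gamma x) := by gcongr
    _ = _ := by field_simp



/-- The halving construction: if `K ⊆ ℝ^{2n}` is a symmetric convex body containing the
Euclidean unit ball `E` with `Vol(K)/Vol(E) ≤ r^{2n}`, then there are an `(n+1)`-dimensional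
subspace `V'`, an `n`-dimensional subspace `V'' ⊆ V'`, and `s > 0` equal to the maximal norm of
a point of the slice `K' = K ∩ V'`, such that the slice `K'' = K ∩ V''` and the unit ball `E''`
of `V''` satisfy `Vol(K'')/Vol(E'') ≤ (2r)^{2n}·s^{-n}`. -/
theorem halving_slice_estimate (n : ℕ) (hn : 2 ≤ n) (r : ℝ)
    (K : Set (EuclideanSpace ℝ (Fin (2 * n))))
    (hKconv : Convex ℝ K) (hKcomp : IsCompact K) (hKint : (interior K).Nonempty)
    (hKsymm : ∀ x ∈ K, -x ∈ K)
    (hEK : Metric.closedBall (0 : EuclideanSpace ℝ (Fin (2 * n))) 1 ⊆ K)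
    (hsemi : (volume K).toReal ≤
      r ^ (2 * n) * (volume (Metric.closedBall (0 : EuclideanSpace ℝ (Fin (2 * n))) 1)).toReal) :
    ∃ (V' V'' : Submodule ℝ (EuclideanSpace ℝ (Fin (2 * n)))) (s : ℝ),
      Module.finrank ℝ V' = n + 1 ∧ Module.finrank ℝ V'' = n ∧ V'' ≤ V' ∧ 0 < s ∧
      (∃ p ∈ K ∩ V', ‖p‖ = s) ∧ (∀ x ∈ K ∩ V', ‖x‖ ≤ s) ∧
      (volume ((↑) ⁻¹' K : Set ↥V'')).toReal ≤
        (2 * r) ^ (2 * n) / s ^ n * (volume (Metric.closedBall (0 : ↥V'') 1)).toReal := by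
  have hdim : Module.finrank ℝ (EuclideanSpace ℝ (Fin (n + 1))) = n + 1 := by simp
  obtain ⟨L, hL⟩ := exists_linearIsometry_setLIntegral_le
    (E := EuclideanSpace ℝ (Fin (2 * n))) (F := EuclideanSpace ℝ (Fin (n + 1)))
    (by simp; lia) hKcomp.measurableSet
  set A : Set (EuclideanSpace ℝ (Fin (n + 1))) := L ⁻¹' K
  have hAcomp : IsCompact A := L.isometry.isClosedEmbedding.isCompact_preimage hKcomp
  have hAconv : Convex ℝ A := hKconv.linear_preimage L.toLinearMap
  have hAball : Metric.closedBall 0 1 ⊆ A := fun x hx =>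
    hEK (by simpa [L.norm_map] using hx)
  obtain ⟨p, hpA, hpmax⟩ := hAcomp.exists_isMaxOn ⟨0, hAball (by simp)⟩ continuous_norm.continuousOn
  have hp1 : 1 ≤ ‖p‖ := by
    obtain ⟨e, he⟩ := exists_norm_eq (EuclideanSpace ℝ (Fin (n + 1))) zero_le_one
    simpa [he] using hpmax (hAball (by simp [he] : e ∈ Metric.closedBall 0 1))
  have hs : 0 < ‖p‖ := by linarith
  have hp0 : p ≠ 0 := norm_pos_iff.1 hs
  have : Fact (Module.finrank ℝ (EuclideanSpace ℝ (Fin (n + 1))) = n + 1) := ⟨hdim⟩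
  have hW : Module.finrank ℝ (ℝ ∙ p)ᗮ = n := Submodule.finrank_orthogonal_span_singleton hp0
  let L' := L.comp (ℝ ∙ p)ᗮ.subtypeₗᵢ
  have hV'' : Module.finrank ℝ (LinearMap.range L'.toLinearMap) = n := by
    rw [LinearMap.finrank_range_of_inj L'.injective, hW]
  refine ⟨LinearMap.range L.toLinearMap, LinearMap.range L'.toLinearMap, ‖p‖, ?_, hV'', ?_, hs,
    ⟨L p, ⟨hpA, p, rfl⟩, L.norm_map p⟩, ?_, ?_⟩
  · rw [LinearMap.finrank_range_of_inj L.injective, hdim]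
  · rintro _ ⟨w, rfl⟩
    exact ⟨w, rfl⟩
  · rintro _ ⟨hx, y, rfl⟩
    exact (L.norm_map y).trans_le (hpmax hx)
  have hslice : volume ((↑) ⁻¹' K : Set (LinearMap.range L'.toLinearMap)) =
      volume ((↑) ⁻¹' A : Set (ℝ ∙ p)ᗮ) :=
    (L'.equivRange.measurePreserving.measure_preimage
      (measurable_subtype_coe hKcomp.measurableSet).nullMeasurableSet).symm
  have hcone := cone_le_setLIntegral_norm_pow hAconv hAcomp.measurableSet hpA hp0 (n - 1) n hW
  have hexp : Module.finrank ℝ (EuclideanSpace ℝ (Fin (2 * n))) -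
      Module.finrank ℝ (EuclideanSpace ℝ (Fin (n + 1))) = n - 1 := by simp; lia
  rw [hexp] at hL
  replace hL := (mul_le_mul' le_rfl hcone).trans hL
  rw [hslice]
  have : Nontrivial (LinearMap.range L'.toLinearMap) :=
    Module.finrank_pos_iff.1 (by rw [hV'']; lia)
  have : Nontrivial (EuclideanSpace ℝ (Fin (2 * n))) :=
    Module.finrank_pos_iff (R := ℝ).1 (by rw [finrank_euclideanSpace_fin]; lia)
  have hbE : 0 < (volume (Metric.closedBall (0 : EuclideanSpace ℝ (Fin (2 * n))) 1)).toReal :=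
    ENNReal.toReal_pos (Metric.measure_closedBall_pos _ _ one_pos).ne'
      measure_closedBall_lt_top.ne
  replace hL := ENNReal.toReal_mono (by finiteness [(hKcomp.measure_lt_top (μ := volume)).ne]) hL
  rw [← Measure.addHaar_closedBall_eq_addHaar_ball, ← Measure.addHaar_closedBall_eq_addHaar_ball,
    show n - 1 + 1 = n by lia, show n - 1 + n + 1 = 2 * n by lia] at hL
  set ωE := (volume (Metric.closedBall (0 : EuclideanSpace ℝ (Fin (2 * n))) 1)).toReal
  have hω := unitBall_volume_ratio_le hn
  set c : ℝ := (n - 1).factorial * n.factorial / (2 * n).factorial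
  have hc0 : 0 < c := by positivity
  have hb0 : (volume (Metric.closedBall (0 : LinearMap.range L'.toLinearMap) 1)).toReal =
      √Real.pi ^ n / Real.Gamma ((n : ℝ) / 2 + 1) := by
    have : 0 < Real.Gamma ((n : ℝ) / 2 + 1) := Real.Gamma_pos_of_pos (by positivity)
    rw [InnerProductSpace.volume_closedBall, hV'', ENNReal.ofReal_one, one_pow, one_mul,
      ENNReal.toReal_ofReal (by positivity)]
  have hb1 : (volume (Metric.closedBall (0 : EuclideanSpace ℝ (Fin (n + 1))) 1)).toReal =
      √Real.pi ^ (n + 1) / Real.Gamma (((n + 1 : ℕ) : ℝ) / 2 + 1) := by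
    have : 0 < Real.Gamma (((n + 1 : ℕ) : ℝ) / 2 + 1) := Real.Gamma_pos_of_pos (by positivity)
    rw [InnerProductSpace.volume_closedBall, hdim, ENNReal.ofReal_one, one_pow, one_mul,
      ENNReal.toReal_ofReal (by positivity)]
  simp only [ENNReal.toReal_mul, hb1, finrank_euclideanSpace_fin, ENNReal.toReal_natCast] at hL
  rw [ENNReal.toReal_ofReal (by positivity)] at hL
  rw [hb0]
  set b0 := √Real.pi ^ n / Real.Gamma ((n : ℝ) / 2 + 1)
  set b1 := √Real.pi ^ (n + 1) / Real.Gamma (((n + 1 : ℕ) : ℝ) / 2 + 1)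
  set v := (volume ((↑) ⁻¹' A : Set (ℝ ∙ p)ᗮ)).toReal
  have hn0 : (0 : ℝ) < n := by positivity
  have hb1n : 0 ≤ b1 := hb1 ▸ ENNReal.toReal_nonneg
  have hr : 0 ≤ r ^ (2 * n) := (even_two_mul n).pow_nonneg r
  push_cast at hL
  rw [div_mul_eq_mul_div, le_div_iff₀ (by positivity)]
  refine le_of_mul_le_mul_left ?_ (show 0 < 2 * n * ωE * c by positivity)
  calc 2 * n * ωE * c * (v * ‖p‖ ^ n) = 2 * n * ωE * (‖p‖ ^ n * c * v) := by ring
    _ ≤ (n + 1) * b1 * (volume K).toReal := hL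
    _ ≤ (n + 1) * b1 * (r ^ (2 * n) * ωE) := by gcongr
    _ ≤ (2 * n * c * 4 ^ n * b0) * (r ^ (2 * n) * ωE) := by gcongr
    _ = _ := by rw [mul_pow, pow_mul 2 2 n]; norm_num; ring
end

section
/- Let K be a 2n-dimensional symmetric convex body that is 8-semiround. Then K has an n-dimensional slice of a slice (hence a subquotient) K'' that is 256-round, i.e., there is an ellipsoid E'' with E'' ⊆ K'' ⊆ 256·E''. -/
open MeasureTheory Pointwise

/-- An ellipsoid: the image of the closed Euclidean unit ball under a linear bijection. -/
def IsEllipsoid {V : Type*} [NormedAddCommGroup V] [NormedSpace ℝ V] (E : Set V) : Prop :=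
  ∃ (m : ℕ) (L : EuclideanSpace ℝ (Fin m) →ₗ[ℝ] V), Function.Bijective L ∧
    E = L '' Metric.closedBall 0 1

open Module Set Metric ENNReal

section RadialIntegral

variable {E : Type*} [NormedAddCommGroup E] [NormedSpace ℝ E] [MeasurableSpace E]
  [Nontrivial E] [FiniteDimensional ℝ E] [BorelSpace E]

/-- The `ℝ≥0∞`-valued integral of a radial function in polar coordinates. -/
theorem lintegral_fun_norm_addHaar_s16 (μ : Measure E) [μ.IsAddHaarMeasure] {f : ℝ → ℝ≥0∞}
    (hf : Measurable f) :
    ∫⁻ x, f ‖x‖ ∂μ = finrank ℝ E * μ (ball 0 1) *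
      ∫⁻ r in Ioi (0 : ℝ), ENNReal.ofReal (r ^ (finrank ℝ E - 1)) * f r :=
  calc
    ∫⁻ x, f ‖x‖ ∂μ = ∫⁻ x : ({(0)}ᶜ : Set E), f ‖x.1‖ ∂(μ.comap (↑)) := by
      rw [lintegral_subtype_comap (measurableSet_singleton _).compl fun x ↦ f ‖x‖,
        restrict_compl_singleton]
    _ = ∫⁻ x, f x.2 ∂μ.toSphere.prod (.volumeIoiPow (finrank ℝ E - 1)) := by
      simpa using μ.measurePreserving_homeomorphUnitSphereProd.lintegral_comp_emb
        (Homeomorph.measurableEmbedding _) (f ∘ Subtype.val ∘ Prod.snd)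
    _ = μ.toSphere univ * ∫⁻ r : Ioi (0 : ℝ), f r ∂.volumeIoiPow (finrank ℝ E - 1) := by
      rw [lintegral_prod _ (by fun_prop)]
      simp [mul_comm]
    _ = _ := by
      rw [Measure.volumeIoiPow, lintegral_withDensity_eq_lintegral_mul _ (by fun_prop)
        (by fun_prop), μ.toSphere_apply_univ]
      simp only [Pi.mul_apply]
      rw [lintegral_subtype_comap measurableSet_Ioi
        fun r : ℝ ↦ ENNReal.ofReal (r ^ (finrank ℝ E - 1)) * f r]

/-- Comparison of the integrals of one radial profile over spaces of dimensions `d + k` and `d`. -/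
theorem lintegral_norm_pow_mul_fun_norm_addHaar {F : Type*} [NormedAddCommGroup F]
    [NormedSpace ℝ F] [MeasurableSpace F] [Nontrivial F] [FiniteDimensional ℝ F] [BorelSpace F]
    (μ : Measure E) [μ.IsAddHaarMeasure] (ν : Measure F) [ν.IsAddHaarMeasure]
    {k : ℕ} (hk : finrank ℝ E = finrank ℝ F + k) {f : ℝ → ℝ≥0∞} (hf : Measurable f) :
    finrank ℝ E * μ (ball 0 1) * ∫⁻ y, ENNReal.ofReal (‖y‖ ^ k) * f ‖y‖ ∂ν =
      finrank ℝ F * ν (ball 0 1) * ∫⁻ x, f ‖x‖ ∂μ := by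
  rw [lintegral_fun_norm_addHaar_s16 μ hf,
    lintegral_fun_norm_addHaar_s16 ν (f := fun r ↦ ENNReal.ofReal (r ^ k) * f r) (by fun_prop),
    mul_left_comm]
  congr 2
  refine setLIntegral_congr_fun measurableSet_Ioi fun r hr ↦ ?_
  have hF : 0 < finrank ℝ F := finrank_pos
  rw [← mul_assoc, ← ENNReal.ofReal_mul (pow_nonneg (le_of_lt hr) _), ← pow_add, hk]
  congr 4
  omega

end RadialIntegral

section OrthogonalAverage

variable {E : Type*} [NormedAddCommGroup E] [InnerProductSpace ℝ E] [FiniteDimensional ℝ E]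

instance compactSpace_unitary : CompactSpace (unitary (E →L[ℝ] E)) := by
  refine (isCompact_iff_compactSpace (s := (unitary (E →L[ℝ] E) : Set (E →L[ℝ] E)))).mp ?_
  refine isCompact_of_isClosed_isBounded isClosed_unitary ?_
  refine isBounded_closedBall (x := (0 : E →L[ℝ] E)) (r := 1) |>.subset fun u hu ↦ ?_
  rw [mem_closedBall_zero_iff]
  refine ContinuousLinearMap.opNorm_le_bound _ zero_le_one fun x ↦ ?_
  rw [one_mul]
  exact (Unitary.linearIsometryEquiv ⟨u, hu⟩).norm_map x |>.le

/-- The orthogonal group acts transitively on spheres. -/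
theorem exists_unitary_apply_eq {x y : E} (h : ‖x‖ = ‖y‖) :
    ∃ u : unitary (E →L[ℝ] E), (u : E →L[ℝ] E) x = y :=
  ⟨Unitary.linearIsometryEquiv.symm ((ℝ ∙ (x - y))ᗮ.reflection), by
    simpa using Submodule.reflection_sub h⟩

variable [MeasurableSpace E] [BorelSpace E]

/-- Averaging over the orthogonal group: some rotation of a fixed subspace meets `K` in a slice
whose `k`-th norm moment, `k` being the codimension, is at most the average one. -/
theorem exists_linearIsometryEquiv_lintegral_norm_pow_le {F : Type*} [NormedAddCommGroup F]
    [NormedSpace ℝ F] [MeasurableSpace F] [Nontrivial E] [Nontrivial F] [FiniteDimensional ℝ F]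
    [BorelSpace F] (ν : Measure F) [ν.IsAddHaarMeasure]
    {k : ℕ} (hk : finrank ℝ E = finrank ℝ F + k) (i : F →ₗᵢ[ℝ] E) {K : Set E} (hK : IsClosed K) :
    ∃ U : E ≃ₗᵢ[ℝ] E, finrank ℝ E * volume (ball (0 : E) 1) *
        ∫⁻ y in {y | U (i y) ∈ K}, ENNReal.ofReal (‖y‖ ^ k) ∂ν ≤
      finrank ℝ F * ν (ball 0 1) * volume K := by
  let G := unitary (E →L[ℝ] E)
  let _ : MeasurableSpace G := borel G
  have : BorelSpace G := ⟨rfl⟩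
  let μ : Measure G := Measure.haarMeasure ⊤
  have : IsProbabilityMeasure μ := ⟨Measure.haarMeasure_self⟩
  have hcont : Continuous fun z : G × E ↦ ((z.1⁻¹ : G) : E →L[ℝ] E) z.2 := by
    simp only [G, ← Unitary.star_eq_inv, Unitary.coe_star]
    fun_prop
  have hmeas : MeasurableSet {z : G × E | ((z.1⁻¹ : G) : E →L[ℝ] E) z.2 ∈ K} :=
    (hK.preimage hcont).measurableSet
  let p : E → ℝ≥0∞ := fun x ↦ μ {u | ((u⁻¹ : G) : E →L[ℝ] E) x ∈ K}
  have hp : Measurable p := measurable_measure_prodMk_right hmeas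
  have hp_norm {x y : E} (h : ‖x‖ = ‖y‖) : p x = p y := by
    obtain ⟨v, rfl⟩ := exists_unitary_apply_eq h
    simp only [p]
    rw [← measure_preimage_mul μ v {u | ((u⁻¹ : G) : E →L[ℝ] E) ((v : E →L[ℝ] E) x) ∈ K}]
    congr 1
    ext u
    have : ((v * u)⁻¹ : G) * v = u⁻¹ := by group
    simp only [mem_preimage, mem_ofPred_eq, ← this]
    rfl
  obtain ⟨e, he⟩ := exists_norm_eq E zero_le_one
  have hf : Measurable fun r : ℝ ↦ p (r • e) := hp.comp (by fun_prop)
  have hpe (x : E) : p (‖x‖ • e) = p x := hp_norm (by simp [norm_smul, he])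
  have key := lintegral_norm_pow_mul_fun_norm_addHaar (volume : Measure E) ν hk hf
  have hE : ∫⁻ x : E, p (‖x‖ • e) = volume K := by
    simp_rw [hpe]
    calc ∫⁻ x, p x = (μ.prod volume) {z : G × E | ((z.1⁻¹ : G) : E →L[ℝ] E) z.2 ∈ K} :=
          (Measure.prod_apply_symm hmeas).symm
      _ = ∫⁻ u, volume {x | ((u⁻¹ : G) : E →L[ℝ] E) x ∈ K} ∂μ := Measure.prod_apply hmeas
      _ = ∫⁻ _, volume K ∂μ := by
          congr 1 with u
          exact (Unitary.linearIsometryEquiv u⁻¹).measurePreserving.measure_preimage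
            hK.measurableSet.nullMeasurableSet
      _ = volume K := by simp
  let w : G → F → ℝ≥0∞ := fun u y ↦
    {y | ((u⁻¹ : G) : E →L[ℝ] E) (i y) ∈ K}.indicator (fun y ↦ ENNReal.ofReal (‖y‖ ^ k)) y
  have hw : Measurable (Function.uncurry w) := by
    have : MeasurableSet {z : G × F | ((z.1⁻¹ : G) : E →L[ℝ] E) (i z.2) ∈ K} :=
      hmeas.preimage (f := fun z : G × F ↦ (z.1, i z.2)) (by fun_prop)
    exact (Measurable.indicator (f := fun z : G × F ↦ ENNReal.ofReal (‖z.2‖ ^ k))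
      (by fun_prop) this)
  have hF : ∫⁻ y, ENNReal.ofReal (‖y‖ ^ k) * p (‖y‖ • e) ∂ν = ∫⁻ u, ∫⁻ y, w u y ∂ν ∂μ := by
    rw [lintegral_lintegral_swap hw.aemeasurable]
    congr 1 with y
    rw [← i.norm_map, hpe, i.norm_map]
    have : MeasurableSet {u : G | ((u⁻¹ : G) : E →L[ℝ] E) (i y) ∈ K} :=
      hmeas.preimage (f := fun u : G ↦ (u, i y)) (by fun_prop)
    rw [← lintegral_indicator_const this]
    rfl
  rw [hE, hF] at key
  obtain ⟨u, hu⟩ := exists_le_lintegral (μ := μ)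
    (hw.lintegral_prod_right' (ν := ν)).aemeasurable
  refine ⟨Unitary.linearIsometryEquiv u⁻¹, (mul_le_mul_right ?_ _).trans key.le⟩
  refine le_trans (le_of_eq ?_) hu
  exact (lintegral_indicator (hK.preimage (by fun_prop)).measurableSet _).symm

end OrthogonalAverage

/-- A convex set containing the unit ball and a point `z` has a large norm moment, since it contains
the ball of radius `1 / 2` around `z / 2`. -/
theorem ofReal_norm_div_four_pow_mul_measure_ball_le {F : Type*} [NormedAddCommGroup F]
    [NormedSpace ℝ F] [MeasurableSpace F] [FiniteDimensional ℝ F] [BorelSpace F]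
    (ν : Measure F) [ν.IsAddHaarMeasure] {Q : Set F} (hQ : Convex ℝ Q) (hball : ball 0 1 ⊆ Q)
    {z : F} (hz : z ∈ Q) :
    ENNReal.ofReal ((‖z‖ / 4) ^ finrank ℝ F) * ν (ball 0 1) ≤
      2 * ∫⁻ y in Q, ENNReal.ofReal (‖y‖ ^ finrank ℝ F) ∂ν := by
  set k := finrank ℝ F
  set c : F := (1 / 2 : ℝ) • z with hc
  have hsub : ball c (1 / 2) ⊆ Q := by
    intro y hy
    have hy' : (2 : ℝ) • (y - c) ∈ ball (0 : F) 1 := by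
      rw [mem_ball, dist_eq_norm] at hy
      rw [mem_ball_zero_iff, norm_smul, Real.norm_two]
      linarith
    have := hQ hz (hball hy') (a := 1 / 2) (b := 1 / 2) (by norm_num) (by norm_num) (by norm_num)
    rwa [← hc, smul_smul, one_div_mul_cancel two_ne_zero, one_smul, add_sub_cancel] at this
  let h : F → ℝ≥0∞ := (ball c (1 / 2)).indicator fun y ↦ ENNReal.ofReal (‖y‖ ^ k)
  have hh : Measurable h := Measurable.indicator (by fun_prop) measurableSet_ball
  have hpt (u : F) : (ball (0 : F) (1 / 2)).indicator (fun _ ↦ ENNReal.ofReal (‖c‖ ^ k)) u ≤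
      h (c + u) + h (c - u) := by
    by_cases hu : u ∈ ball (0 : F) (1 / 2)
    · have h₁ : c + u ∈ ball c (1 / 2) := by simpa [dist_eq_norm] using hu
      have h₂ : c - u ∈ ball c (1 / 2) := by simpa [dist_eq_norm] using hu
      simp only [h, indicator_of_mem hu, indicator_of_mem h₁, indicator_of_mem h₂]
      have htri : 2 * ‖c‖ ≤ ‖c + u‖ + ‖c - u‖ := by
        calc 2 * ‖c‖ = ‖(c + u) + (c - u)‖ := by
              rw [← Real.norm_two, ← norm_smul]; congr 1; module
          _ ≤ _ := norm_add_le _ _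
      rcases le_total ‖c‖ ‖c + u‖ with hle | hle
      · exact le_add_right (ENNReal.ofReal_le_ofReal (by gcongr))
      · refine le_add_left (ENNReal.ofReal_le_ofReal ?_)
        gcongr
        linarith
    · rw [indicator_of_notMem hu]
      exact zero_le
  calc ENNReal.ofReal ((‖z‖ / 4) ^ k) * ν (ball 0 1)
      = ENNReal.ofReal (‖c‖ ^ k) * ν (ball 0 (1 / 2)) := by
        rw [Measure.addHaar_ball_of_pos ν _ (r := 1 / 2) (by norm_num), ← mul_assoc,
          ← ENNReal.ofReal_mul (by positivity), ← mul_pow, hc, norm_smul]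
        congr 3
        norm_num
        ring
    _ = ∫⁻ u, (ball (0 : F) (1 / 2)).indicator (fun _ ↦ ENNReal.ofReal (‖c‖ ^ k)) u ∂ν :=
        (lintegral_indicator_const measurableSet_ball _).symm
    _ ≤ ∫⁻ u, h (c + u) + h (c - u) ∂ν := lintegral_mono hpt
    _ = 2 * ∫⁻ y in ball c (1 / 2), ENNReal.ofReal (‖y‖ ^ k) ∂ν := by
        rw [lintegral_add_left (by fun_prop), lintegral_add_left_eq_self,
          lintegral_sub_left_eq_self, ← two_mul, lintegral_indicator measurableSet_ball]
    _ ≤ _ := by gcongr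

theorem nonempty_linearIsometry_of_finrank_le {E F : Type*} [NormedAddCommGroup E]
    [InnerProductSpace ℝ E] [FiniteDimensional ℝ E] [NormedAddCommGroup F]
    [InnerProductSpace ℝ F] [FiniteDimensional ℝ F] (h : finrank ℝ F ≤ finrank ℝ E) :
    Nonempty (F →ₗᵢ[ℝ] E) := by
  let b := stdOrthonormalBasis ℝ F
  let v : Fin (finrank ℝ F) → E := stdOrthonormalBasis ℝ E ∘ Fin.castLE h
  refine ⟨(b.toBasis.constr ℝ v).isometryOfOrthonormal (v := b.toBasis) (by simp) ?_⟩
  have hv : b.toBasis.constr ℝ v ∘ b.toBasis = v := funext fun i ↦ b.toBasis.constr_basis ℝ v i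
  rw [hv]
  exact (stdOrthonormalBasis ℝ E).orthonormal.comp _ (Fin.castLE_injective h)

/-- A convex set containing the unit ball and of volume at most `r ^ dim E` times that of the unit
ball has a slice of half the dimension contained in the ball of radius `4 * r ^ 2`. -/
theorem exists_linearIsometry_norm_le {E F : Type*} [NormedAddCommGroup E]
    [InnerProductSpace ℝ E] [FiniteDimensional ℝ E] [MeasurableSpace E] [BorelSpace E]
    [Nontrivial E] [NormedAddCommGroup F] [InnerProductSpace ℝ F] [FiniteDimensional ℝ F]
    [Nontrivial F] (hEF : finrank ℝ E = 2 * finrank ℝ F)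
    {K : Set E} (hK : IsClosed K) (hKc : Convex ℝ K) (hball : ball 0 1 ⊆ K)
    {r : ℝ} (hvol : volume K ≤
      ENNReal.ofReal (r ^ finrank ℝ E) * volume (ball (0 : E) 1)) :
    ∃ i : F →ₗᵢ[ℝ] E, ∀ z, i z ∈ K → ‖z‖ ≤ 4 * r ^ 2 := by
  let _ : MeasurableSpace F := borel F
  have : BorelSpace F := ⟨rfl⟩
  obtain ⟨j⟩ := nonempty_linearIsometry_of_finrank_le (E := E) (F := F) (by omega)
  obtain ⟨U, hU⟩ := exists_linearIsometryEquiv_lintegral_norm_pow_le (volume : Measure F)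
    (hEF.trans (two_mul _)) j hK
  refine ⟨U.toLinearIsometry.comp j, fun z hz ↦ ?_⟩
  set Q : Set F := {y | U (j y) ∈ K}
  have hQ : Convex ℝ Q := hKc.linear_preimage (U.toLinearIsometry.comp j).toLinearMap
  have hQball : ball 0 1 ⊆ Q := fun y hy ↦ hball (by simpa using hy)
  have hlow := ofReal_norm_div_four_pow_mul_measure_ball_le (volume : Measure F) hQ hQball hz
  set k := finrank ℝ F
  set I := ∫⁻ y in Q, ENNReal.ofReal (‖y‖ ^ k)
  set b := volume (ball (0 : E) 1)
  set a := volume (ball (0 : F) 1)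
  have hk : 0 < k := finrank_pos
  have hC₀ : (k : ℝ≥0∞) * b * a ≠ 0 :=
    mul_ne_zero (mul_ne_zero (by exact_mod_cast hk.ne') (measure_ball_pos _ _ one_pos).ne')
      (measure_ball_pos _ _ one_pos).ne'
  have hC : (k : ℝ≥0∞) * b * a ≠ ∞ :=
    ENNReal.mul_ne_top (ENNReal.mul_ne_top (ENNReal.natCast_ne_top _) measure_ball_lt_top.ne)
      measure_ball_lt_top.ne
  have hpow : (k * b * a) * ENNReal.ofReal ((‖z‖ / 4) ^ k) ≤
      (k * b * a) * ENNReal.ofReal ((r ^ 2) ^ k) :=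
    calc _ = k * b * (ENNReal.ofReal ((‖z‖ / 4) ^ k) * a) := by ring
      _ ≤ k * b * (2 * I) := by gcongr
      _ = finrank ℝ E * b * I := by rw [hEF]; push_cast; ring
      _ ≤ k * a * volume K := hU
      _ ≤ k * a * (ENNReal.ofReal (r ^ finrank ℝ E) * b) := by gcongr
      _ = _ := by rw [hEF, pow_mul]; ring
  rw [ENNReal.mul_le_mul_iff_right hC₀ hC, ENNReal.ofReal_le_ofReal_iff (by positivity),
    pow_le_pow_iff_left₀ (by positivity) (by positivity) hk.ne'] at hpow
  linarith

/-- A `2n`-dimensional symmetric convex body that is `8`-semiround has an `n`-dimensional slice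
(of a slice, hence a subquotient) `K''` that is `256`-round: there is an ellipsoid `E''` with
`E'' ⊆ K'' ⊆ 256·E''`. -/
theorem semiround_eight_has_round_slice (n : ℕ) (hn : 1 ≤ n)
    (K : Set (EuclideanSpace ℝ (Fin (2 * n))))
    (hKconv : Convex ℝ K) (hKcomp : IsCompact K) (hKint : (interior K).Nonempty)
    (hKsymm : ∀ x ∈ K, -x ∈ K)
    (E : Set (EuclideanSpace ℝ (Fin (2 * n)))) (hE : IsEllipsoid E) (hEK : E ⊆ K)
    (hsemi : (volume K).toReal ≤ 8 ^ (2 * n) * (volume E).toReal) :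
    ∃ V'' : Submodule ℝ (EuclideanSpace ℝ (Fin (2 * n))),
      Module.finrank ℝ V'' = n ∧
      ∃ E'' : Set ↥V'', IsEllipsoid E'' ∧
        E'' ⊆ ((↑) ⁻¹' K : Set ↥V'') ∧
        ((↑) ⁻¹' K : Set ↥V'') ⊆ (256 : ℝ) • E'' := by
  obtain ⟨m, L, hL, rfl⟩ := hE
  obtain rfl : m = 2 * n := by
    simpa using (LinearEquiv.ofBijective L hL).finrank_eq
  have : NeZero n := ⟨by omega⟩
  have hB : closedBall 0 1 ⊆ L ⁻¹' K := image_subset_iff.mp hEK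
  have hdet : LinearMap.det L ≠ 0 :=
    (LinearEquiv.ofBijective L hL).isUnit_det'.ne_zero
  have hvol : volume (L ⁻¹' K) ≤
      ENNReal.ofReal (8 ^ (2 * n)) * volume (ball (0 : EuclideanSpace ℝ (Fin (2 * n))) 1) := by
    have hKL : volume K = ENNReal.ofReal |LinearMap.det L| * volume (L ⁻¹' K) := by
      rw [← Measure.addHaar_image_linearMap, image_preimage_eq _ hL.surjective]
    have hfin : volume (L '' closedBall 0 1) ≠ ∞ :=
      ((measure_mono hEK).trans_lt hKcomp.measure_lt_top).ne
    have hle : volume K ≤ ENNReal.ofReal (8 ^ (2 * n)) * volume (L '' closedBall 0 1) := by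
      rw [← ENNReal.ofReal_toReal hfin, ← ENNReal.ofReal_mul (by positivity)]
      exact ENNReal.le_ofReal_iff_toReal_le hKcomp.measure_lt_top.ne (by positivity) |>.mpr hsemi
    rwa [hKL, Measure.addHaar_image_linearMap, mul_left_comm,
      Measure.addHaar_unitClosedBall_eq_addHaar_unitBall,
      ENNReal.mul_le_mul_iff_right (by simpa using hdet) ENNReal.ofReal_ne_top] at hle
  obtain ⟨i, hi⟩ := exists_linearIsometry_norm_le (F := EuclideanSpace ℝ (Fin n)) (by simp)
    (hKcomp.isClosed.preimage L.continuous_of_finiteDimensional) (hKconv.linear_preimage L)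
    (ball_subset_closedBall.trans hB) (r := 8) (by simpa using hvol)
  let T := L ∘ₗ i.toLinearMap
  have hT : Function.Injective T := hL.injective.comp i.injective
  refine ⟨LinearMap.range T, by simp [LinearMap.finrank_range_of_inj hT],
    LinearEquiv.ofInjective T hT '' closedBall 0 1,
    ⟨n, (LinearEquiv.ofInjective T hT).toLinearMap, (LinearEquiv.ofInjective T hT).bijective, rfl⟩,
    ?_, ?_⟩
  · rintro _ ⟨y, hy, rfl⟩
    exact hB (by simpa using hy)
  · intro v hv
    obtain ⟨z, rfl⟩ := (LinearEquiv.ofInjective T hT).surjective v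
    have hz : ‖z‖ ≤ 256 := (hi z hv).trans (by norm_num)
    rw [← image_smul_set, smul_unitClosedBall]
    exact mem_image_of_mem _ (by simpa using hz)
end
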